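/- For all a > 0 and integers n ≥ 0 and i, k ≥ 0 with i + k ≡ n (mod 2), the weighted path count satisfies t_n(i,k) = binom(n, (n−i+k)/2) − binom(n, (n+i+k)/2) + a · Σ_{w=0}^{⌊(n−i−k)/2⌋} [binom(n, (n+i+k)/2 + w) − binom(n, (n+i+k)/2 + w + 1)] (a−1)^w, where binom(n, j) is taken to be 0 if j < 0 or j > n. In particular, at a = 1 the number of such paths is t¹_n(i,k) = binom(n, (n−i+k)/2) − binom(n, (n+i+k)/2 + 1). -/

import Mathlib

open Finset Filter

attribute [local instance] Classical.propDecidable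

/-- Height (second coordinate) of a binomial path after `i` steps, starting at height `c`;
steps are encoded by `s : Fin n → Bool` (`true` = up step `(1,1)`, `false` = down step `(1,-1)`).
The path visits the points `(x₀ + i, hgt c s i)` for `0 ≤ i ≤ n`. -/
def hgt {n : ℕ} (c : ℤ) (s : Fin n → Bool) (i : ℕ) : ℤ :=
  c + ∑ j ∈ Finset.range i, (if h : j < n then (if s ⟨j, h⟩ then (1 : ℤ) else -1) else 0)

/-- The path lies in the upper half-plane (all second coordinates ≥ 0). -/
def InUHP {n : ℕ} (c : ℤ) (s : Fin n → Bool) : Prop :=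
  ∀ i ≤ n, 0 ≤ hgt c s i

/-- The number of vertices of the path with second coordinate 0. -/
def visits {n : ℕ} (c : ℤ) (s : Fin n → Bool) : ℕ :=
  ((Finset.range (n + 1)).filter (fun i => hgt c s i = 0)).card

/-- `binom(n, j)` for an integer argument `j`, taken to be `0` if `j < 0` (and it is `0`
for `j > n` by the convention for `Nat.choose`). -/
def chooseZ (n : ℕ) (j : ℤ) : ℕ := if 0 ≤ j then n.choose j.toNat else 0

/-- `t_n(i,k)`: the sum, over all binomial paths of length `n` in the upper half-plane
from `(0,i)` to `(n,k)`, of `a` raised to the number of vertices with second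
coordinate `0`. -/
noncomputable def tW (a : ℝ) (n i k : ℕ) : ℝ :=
  ∑ s ∈ (Finset.univ : Finset (Fin n → Bool)).filter
      (fun s => InUHP (i : ℤ) s ∧ hgt (i : ℤ) s n = (k : ℤ)),
    a ^ visits (i : ℤ) s


/-- Integer version of `tW`, as a sum over all paths. -/
noncomputable def tZ (a : ℝ) (n : ℕ) (c k : ℤ) : ℝ :=
  ∑ s : Fin n → Bool, if InUHP c s ∧ hgt c s n = k then a ^ visits c s else 0

lemma tW_eq_tZ (a : ℝ) (n i k : ℕ) : tW a n i k = tZ a n i k := by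
  unfold tW tZ
  rw [Finset.sum_filter]

lemma hgt_zero {n : ℕ} (c : ℤ) (s : Fin n → Bool) : hgt c s 0 = c := by
  simp [hgt]

lemma hgt_cons {n : ℕ} (c : ℤ) (b : Bool) (s : Fin n → Bool) (j : ℕ) :
    hgt c (Fin.cons b s : Fin (n + 1) → Bool) (j + 1)
      = hgt (c + if b then 1 else -1) s j := by
  unfold hgt
  rw [Finset.sum_range_succ']
  have h0 : (if h : 0 < n + 1 then
      (if (Fin.cons b s : Fin (n + 1) → Bool) ⟨0, h⟩ then (1 : ℤ) else -1) else 0)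
      = if b then 1 else -1 := by
    rw [dif_pos (Nat.succ_pos n)]
    rfl
  rw [h0]
  have h1 : ∀ x : ℕ, (if h : x + 1 < n + 1 then
      (if (Fin.cons b s : Fin (n + 1) → Bool) ⟨x + 1, h⟩ then (1 : ℤ) else -1) else 0)
      = (if h : x < n then (if s ⟨x, h⟩ then (1 : ℤ) else -1) else 0) := by
    intro x
    by_cases h : x < n
    · rw [dif_pos h, dif_pos (Nat.succ_lt_succ h)]
      rfl
    · rw [dif_neg h, dif_neg (by omega)]
  simp only [h1]
  ring

lemma inUHP_cons {n : ℕ} (c : ℤ) (b : Bool) (s : Fin n → Bool) :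
    InUHP c (Fin.cons b s : Fin (n + 1) → Bool)
      ↔ 0 ≤ c ∧ InUHP (c + if b then 1 else -1) s := by
  unfold InUHP
  constructor
  · intro h
    refine ⟨by simpa [hgt_zero] using h 0 (by omega), fun i hi => ?_⟩
    rw [← hgt_cons]
    exact h (i + 1) (by omega)
  · rintro ⟨h0, h⟩ i hi
    cases i with
    | zero => simpa [hgt_zero] using h0
    | succ j =>
      rw [hgt_cons]
      exact h j (by omega)

lemma visits_cons {n : ℕ} (c : ℤ) (b : Bool) (s : Fin n → Bool) :
    visits c (Fin.cons b s : Fin (n + 1) → Bool)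
      = visits (c + if b then 1 else -1) s + if c = 0 then 1 else 0 := by
  unfold visits
  rw [Finset.card_filter, Finset.card_filter, Finset.sum_range_succ']
  simp only [hgt_cons, hgt_zero]

lemma tZ_neg (a : ℝ) (n : ℕ) (c k : ℤ) (hc : c < 0) : tZ a n c k = 0 := by
  unfold tZ
  apply Finset.sum_eq_zero
  intro s _
  rw [if_neg]
  rintro ⟨h, _⟩
  have := h 0 (by omega)
  rw [hgt_zero] at this
  omega

lemma tZ_zero (a : ℝ) (c k : ℤ) (hc : 0 ≤ c) :
    tZ a 0 c k = if c = k then (if c = 0 then a else 1) else 0 := by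
  have h1 : ∀ s : Fin 0 → Bool, InUHP c s := by
    intro s i hi
    obtain rfl : i = 0 := by omega
    rwa [hgt_zero]
  have h2 : ∀ s : Fin 0 → Bool, visits c s = if c = 0 then 1 else 0 := by
    intro s
    unfold visits
    rw [Finset.card_filter, Finset.sum_range_one, hgt_zero]
  unfold tZ
  simp only [h1, h2, hgt_zero, true_and, Finset.univ_unique, Finset.sum_singleton]
  by_cases h : c = 0 <;> simp [h]

lemma tZ_succ (a : ℝ) (n : ℕ) (c k : ℤ) (hc : 0 ≤ c) :
    tZ a (n + 1) c k
      = (if c = 0 then a else 1) * (tZ a n (c + 1) k + tZ a n (c - 1) k) := by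
  have key : ∀ (b : Bool) (s : Fin n → Bool),
      (if InUHP c (Fin.cons b s : Fin (n + 1) → Bool)
          ∧ hgt c (Fin.cons b s : Fin (n + 1) → Bool) (n + 1) = k
        then a ^ visits c (Fin.cons b s : Fin (n + 1) → Bool) else 0)
      = (if c = 0 then a else 1) *
        (if InUHP (c + if b then 1 else -1) s ∧ hgt (c + if b then 1 else -1) s n = k
          then a ^ visits (c + if b then 1 else -1) s else 0) := by
    intro b s
    simp only [inUHP_cons, hgt_cons, visits_cons, hc, true_and]
    split_ifs <;> ring
  unfold tZ
  rw [← (Fin.consEquiv (fun _ : Fin (n + 1) => Bool)).sum_comp, Fintype.sum_prod_type,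
    Fintype.sum_bool]
  have e : ∀ b : Bool, (∑ s : Fin n → Bool,
      (fun t : Fin (n + 1) → Bool => if InUHP c t ∧ hgt c t (n + 1) = k
        then a ^ visits c t else 0) (Fin.consEquiv (fun _ : Fin (n + 1) => Bool) (b, s)))
      = (if c = 0 then a else 1) * ∑ s : Fin n → Bool,
        (if InUHP (c + if b then 1 else -1) s ∧ hgt (c + if b then 1 else -1) s n = k
          then a ^ visits (c + if b then 1 else -1) s else 0) := by
    intro b
    rw [Finset.mul_sum]
    exact Finset.sum_congr rfl fun s _ => key b s
  refine (congrArg₂ (· + ·) (e true) (e false)).trans ?_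
  simp [sub_eq_add_neg, mul_add]

lemma chooseZ_big (n : ℕ) (j : ℤ) (h : (n : ℤ) < j) : chooseZ n j = 0 := by
  unfold chooseZ
  rw [if_pos (by omega)]
  exact Nat.choose_eq_zero_of_lt (by omega)

lemma chooseZ_zero (j : ℤ) : chooseZ 0 j = if j = 0 then 1 else 0 := by
  rcases lt_trichotomy j 0 with h | h | h
  · simp [chooseZ, h.ne, not_le.2 h]
  · simp [chooseZ, h]
  · rw [chooseZ_big 0 j (by exact_mod_cast h), if_neg h.ne']

lemma chooseZ_succ (n : ℕ) (j : ℤ) :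
    (chooseZ (n + 1) j : ℝ) = chooseZ n (j - 1) + chooseZ n j := by
  rcases lt_trichotomy j 0 with h | h | h
  · simp [chooseZ, not_le.2 h, show ¬ (1 : ℤ) ≤ j by omega]
  · simp [chooseZ, h]
  · obtain ⟨m, rfl⟩ : ∃ m : ℕ, j = m + 1 := ⟨(j - 1).toNat, by omega⟩
    have e : ((m : ℤ) + 1).toNat = m + 1 := by omega
    simp only [chooseZ, add_sub_cancel_right, e, Int.toNat_natCast]
    rw [if_pos (by omega), if_pos (by omega), if_pos (by omega), Nat.choose_succ_succ]
    push_cast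
    ring

/-- difference of consecutive binomials -/
noncomputable def dZ (n : ℕ) (j : ℤ) : ℝ := (chooseZ n j : ℝ) - chooseZ n (j + 1)

lemma dZ_succ (n : ℕ) (j : ℤ) : dZ (n + 1) j = dZ n (j - 1) + dZ n j := by
  unfold dZ
  rw [chooseZ_succ, chooseZ_succ]
  ring_nf

lemma dZ_big (n : ℕ) (j : ℤ) (h : (n : ℤ) < j) : dZ n j = 0 := by
  unfold dZ
  rw [chooseZ_big n j h, chooseZ_big n (j + 1) (by omega)]
  simp

/-- the weighted sum in the formula -/
noncomputable def sZ (a : ℝ) (n : ℕ) (m : ℤ) (N : ℕ) : ℝ :=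
  ∑ w ∈ Finset.range N, dZ n (m + w) * (a - 1) ^ w

lemma sZ_succ (a : ℝ) (n : ℕ) (m : ℤ) (N : ℕ) :
    sZ a (n + 1) m N = sZ a n (m - 1) N + sZ a n m N := by
  unfold sZ
  rw [← Finset.sum_add_distrib]
  refine Finset.sum_congr rfl fun w _ => ?_
  rw [dZ_succ, show m + (w : ℤ) - 1 = m - 1 + w by ring]
  ring

lemma sZ_stable (a : ℝ) (n : ℕ) (m : ℤ) (N M : ℕ) (h : (n : ℤ) < m + N) (hM : N ≤ M) :
    sZ a n m M = sZ a n m N := by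
  unfold sZ
  symm
  apply Finset.sum_subset (Finset.range_mono hM)
  intro w _ hw
  have : N ≤ w := by simpa using hw
  rw [dZ_big n _ (by omega), zero_mul]

lemma sZ_shift (a : ℝ) (n : ℕ) (m : ℤ) (N : ℕ) (h : (n : ℤ) < m + N) :
    sZ a n (m - 1) (N + 1) = dZ n (m - 1) + (a - 1) * sZ a n m N := by
  unfold sZ
  rw [Finset.sum_range_succ', Finset.mul_sum, add_comm]
  congr 1
  · simp
  · refine Finset.sum_congr rfl fun w _ => ?_
    rw [show m - 1 + ((w + 1 : ℕ) : ℤ) = m + w by push_cast; ring]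
    ring

lemma main_formula (a : ℝ) (n : ℕ) : ∀ (N : ℕ) (c k m : ℤ), n < N → 0 ≤ c → 0 ≤ k →
    2 * m = n + c + k →
    tZ a n c k = (chooseZ n (m - c) : ℝ) - chooseZ n m + a * sZ a n m N := by
  induction n with
  | zero =>
    intro N c k m hN hc hk hm
    rw [tZ_zero a c k hc, ← sZ_stable a 0 m N (N + 1) (by push_cast; omega) (by omega)]
    have hS : sZ a 0 m (N + 1) = if m = 0 then 1 else 0 := by
      rw [sZ_stable a 0 m 1 (N + 1) (by push_cast; omega) (by omega)]
      simp [sZ, dZ, chooseZ_zero, show m + 1 ≠ 0 by push_cast at hm; omega]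
    rw [hS, chooseZ_zero, chooseZ_zero]
    push_cast at hm
    by_cases h1 : c = k
    · by_cases h2 : c = 0
      · have : m = 0 := by omega
        have : k = 0 := by omega
        simp [*]
      · have h3 : m - c = 0 := by omega
        have h4 : m ≠ 0 := by omega
        rw [if_pos h1, if_neg h2, if_pos h3, if_neg h4, if_neg h4]
        simp
    · have h3 : m - c ≠ 0 := by omega
      have h4 : m ≠ 0 := by omega
      simp [h1, h3, h4]
  | succ n ih =>
    intro N c k m hN hc hk hm
    push_cast at hm
    rw [tZ_succ a n c k hc, ih N (c + 1) k m (by omega) (by omega) hk (by omega)]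
    by_cases h : c = 0
    · subst h
      rw [tZ_neg a n _ k (by omega)]
      have hb : sZ a n (m - 1) (N + 1) = sZ a n (m - 1) N :=
        sZ_stable a n (m - 1) N (N + 1) (by omega) (by omega)
      rw [sZ_succ, ← hb, sZ_shift a n m N (by omega)]
      simp only [if_true, dZ, sub_zero, zero_add, sub_add_cancel]
      ring
    · rw [if_neg h, ih N (c - 1) k (m - 1) (by omega) (by omega) hk (by omega), sZ_succ,
        chooseZ_succ, chooseZ_succ]
      rw [show m - 1 - (c - 1) = m - c by ring, show m - (c + 1) = m - c - 1 by ring]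
      ring

lemma tW_first (a : ℝ) (n i k : ℕ) (hpar : (i + k) % 2 = n % 2) :
    tW a n i k =
        (chooseZ n (((n : ℤ) - i + k) / 2) : ℝ) - (chooseZ n (((n : ℤ) + i + k) / 2) : ℝ)
          + a * ∑ w ∈ Finset.range ((n - i - k) / 2 + 1),
              ((chooseZ n (((n : ℤ) + i + k) / 2 + w) : ℝ)
                - (chooseZ n (((n : ℤ) + i + k) / 2 + w + 1) : ℝ)) * (a - 1) ^ w := by
  obtain ⟨m, hm⟩ : ∃ m : ℤ, 2 * m = n + i + k := ⟨((n : ℤ) + i + k) / 2, by omega⟩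
  rw [tW_eq_tZ, main_formula a n (n + 1) i k m (by omega) (by omega) (by omega) hm,
    show ((n : ℤ) + i + k) / 2 = m by omega, show ((n : ℤ) - i + k) / 2 = m - i by omega,
    sZ_stable a n m ((n - i - k) / 2 + 1) (n + 1) (by push_cast; omega) (by omega)]
  rfl

/-- The exact formula for the weighted single-path count `t_n(i,k)`, and its
specialisation `t¹_n(i,k)` at `a = 1`. -/
theorem tW_formula (a : ℝ) (ha : 0 < a) (n i k : ℕ) (hpar : (i + k) % 2 = n % 2) :
    tW a n i k =
        (chooseZ n (((n : ℤ) - i + k) / 2) : ℝ) - (chooseZ n (((n : ℤ) + i + k) / 2) : ℝ)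
          + a * ∑ w ∈ Finset.range ((n - i - k) / 2 + 1),
              ((chooseZ n (((n : ℤ) + i + k) / 2 + w) : ℝ)
                - (chooseZ n (((n : ℤ) + i + k) / 2 + w + 1) : ℝ)) * (a - 1) ^ w
      ∧ tW 1 n i k =
        (chooseZ n (((n : ℤ) - i + k) / 2) : ℝ)
          - (chooseZ n (((n : ℤ) + i + k) / 2 + 1) : ℝ) := by
  refine ⟨tW_first a n i k hpar, ?_⟩
  rw [tW_first 1 n i k hpar, Finset.sum_range_succ']
  simp
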